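/- arXiv:1004.2947 — 3 statements merged into one kernel-verified Lean document; each statement's English description precedes it below -/
import Mathlib

section
/- If v ∈ C²([a,b]) with v(a) = v(b) = 0, extended by zero to ℝ, satisfies 𝓛v(x) − 𝓘v(x) = 0 for all x ∈ (a,b), then v is identically zero. -/
open MeasureTheory

/-- The integral operator `𝓘v(x) = λ(∫_a^b φ(x−y) v(y) dy − v(x))`. -/
noncomputable def Iop (a b lam : ℝ) (φ v : ℝ → ℝ) : ℝ → ℝ :=
  fun x => lam * ((∫ y in a..b, φ (x - y) * v y) - v x)

/-- At a local maximum the second derivative is nonpositive. -/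
theorem IsLocalMax.deriv_deriv_nonpos {f : ℝ → ℝ} {x : ℝ} (h : IsLocalMax f x)
    (hf : ContinuousAt f x) : deriv (deriv f) x ≤ 0 := by
  by_contra! hpos
  have hmin := isLocalMin_of_deriv_deriv_pos hpos h.deriv_eq_zero hf
  have heq : f =ᶠ[nhds x] fun _ => f x := by
    filter_upwards [h, hmin] with y h₁ h₂ using le_antisymm h₁ h₂
  have hzero : deriv (deriv f) x = 0 := by
    rw [heq.deriv.deriv_eq]
    simp
  exact hpos.ne' hzero

/-- A function vanishing outside `(a, b)` and continuous on `[a, b]` is continuous. -/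
theorem ContinuousOn.continuous_of_eq_zero_off_Ioo {a b : ℝ} (hab : a ≤ b) {v : ℝ → ℝ}
    (hv0 : ∀ x, x ∉ Set.Ioo a b → v x = 0) (hv : ContinuousOn v (Set.Icc a b)) :
    Continuous v := by
  have h : v = Set.IccExtend hab ((Set.Icc a b).domRestrict v) := by
    funext x
    rcases le_or_gt x a with hx | hx
    · rw [Set.IccExtend_of_le_left _ _ hx]
      simp [hv0 x (fun h => h.1.not_ge hx), hv0 a (by simp)]
    rcases le_or_gt b x with hx' | hx'
    · rw [Set.IccExtend_of_right_le _ _ hx']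
      simp [hv0 x (fun h => h.2.not_ge hx'), hv0 b (by simp)]
    · rw [Set.IccExtend_of_mem _ _ ⟨hx.le, hx'.le⟩]
      rfl
  rw [h]
  exact hv.domRestrict.Icc_extend'

/-- A density is positive at some nonzero point. -/
theorem exists_ne_zero_pos_of_integral_eq_one {φ : ℝ → ℝ} (hφ0 : ∀ y, 0 ≤ φ y)
    (hφ1 : (∫ y, φ y) = 1) : ∃ z, z ≠ 0 ∧ 0 < φ z := by
  by_contra! h
  have hz : φ =ᵐ[volume] 0 := by
    filter_upwards [Measure.ae_ne volume 0] with z hz using le_antisymm (h z hz) (hφ0 z)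
  rw [integral_congr_ae hz] at hφ1
  simp at hφ1

/-- If the average of `v` against the kernel `φ (x - ·)` is at least the global maximum `M` of
`v`, then `v = M` wherever the kernel is positive. -/
theorem eq_of_le_integral_mul {φ v : ℝ → ℝ} {M x : ℝ} (hφc : Continuous φ)
    (hφ0 : ∀ y, 0 ≤ φ y) (hφ1 : (∫ y, φ y) = 1) (hv : Continuous v) (hM : ∀ y, v y ≤ M)
    (hint : Integrable fun y => φ (x - y) * v y) (hle : M ≤ ∫ y, φ (x - y) * v y)
    {z : ℝ} (hz : 0 < φ z) : v (x - z) = M := by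
  have hφi : Integrable φ := by
    by_contra hn
    simp [integral_undef hn] at hφ1
  have hφi' : Integrable fun y => φ (x - y) * M := (hφi.comp_sub_left x).mul_const M
  have hnn : 0 ≤ fun y => φ (x - y) * M - φ (x - y) * v y := fun y => by
    have := mul_le_mul_of_nonneg_left (hM y) (hφ0 (x - y))
    simpa using this
  have hzero : ∫ y, (φ (x - y) * M - φ (x - y) * v y) = 0 := by
    refine le_antisymm ?_ (integral_nonneg hnn)
    rw [integral_sub hφi' hint, integral_mul_const, integral_sub_left_eq_self φ volume x, hφ1]
    linarith
  have hcont : Continuous fun y => φ (x - y) * M - φ (x - y) * v y := by fun_prop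
  have hae := (integral_eq_zero_iff_of_nonneg hnn (hφi'.sub hint)).1 hzero
  have hpt := congrFun ((hcont.ae_eq_iff_eq volume continuous_zero).1 hae) (x - z)
  simp only [sub_sub_cancel, Pi.zero_apply, ← mul_sub] at hpt
  have := (mul_eq_zero.1 hpt).resolve_left hz.ne'
  linarith

/-- Maximum principle: a solution of `𝓛v − 𝓘v = 0` on `(a, b)` vanishing outside is
nonpositive. -/
theorem nonpos_of_integroDifferential_eq_zero {a b σ μ lam : ℝ} (hab : a < b) (hlam : 0 < lam)
    {φ : ℝ → ℝ} (hφc : Continuous φ) (hφ0 : ∀ y, 0 ≤ φ y) (hφ1 : (∫ y, φ y) = 1)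
    {v : ℝ → ℝ} (hv0 : ∀ x, x ∉ Set.Ioo a b → v x = 0) (hv : Continuous v)
    (heq : ∀ x ∈ Set.Ioo a b,
      -(σ ^ 2 / 2) * deriv (deriv v) x + μ * x * deriv v x - Iop a b lam φ v x = 0) (x : ℝ) :
    v x ≤ 0 := by
  by_contra! hx
  have hmem : ∀ {y}, 0 < v y → y ∈ Set.Ioo a b := fun {y} hy => by
    by_contra hn
    exact hy.ne' (hv0 y hn)
  obtain ⟨c, -, hc⟩ := isCompact_Icc.exists_isMaxOn (Set.nonempty_Icc.2 hab.le) hv.continuousOn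
  have hcpos : 0 < v c := hx.trans_le (hc (Set.Ioo_subset_Icc_self (hmem hx)))
  have hmax : ∀ y, v y ≤ v c := fun y => by
    rcases le_or_gt (v y) 0 with hy | hy
    · exact hy.trans hcpos.le
    · exact hc (Set.Ioo_subset_Icc_self (hmem hy))
  obtain ⟨z, hz0, hz⟩ := exists_ne_zero_pos_of_integral_eq_one hφ0 hφ1
  have hshift : ∀ p, v p = v c → v (p - z) = v c := fun p hp => by
    have hpI : p ∈ Set.Ioo a b := hmem (hp ▸ hcpos)
    have hloc : IsLocalMax v p := Filter.Eventually.of_forall fun y => hp ▸ hmax y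
    have hdd := hloc.deriv_deriv_nonpos hv.continuousAt
    have hE := heq p hpI
    have hsupp : Function.support (fun y => φ (p - y) * v y) ⊆ Set.Ioc a b := fun y hy => by
      by_contra hn
      exact hy (by simp [hv0 y fun h => hn (Set.Ioo_subset_Ioc_self h)])
    have hcont : Continuous fun y => φ (p - y) * v y := by fun_prop
    have hint : Integrable fun y => φ (p - y) * v y :=
      (integrableOn_iff_integrable_of_support_subset hsupp).1
        (hcont.integrableOn_Ioc)
    refine eq_of_le_integral_mul hφc hφ0 hφ1 hv hmax hint ?_ hz
    rw [Iop, intervalIntegral.integral_eq_integral_of_support_subset hsupp, hloc.deriv_eq_zero,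
      hp] at hE
    have : 0 ≤ lam * ((∫ y, φ (p - y) * v y) - v c) := by
      nlinarith [mul_nonneg (sq_nonneg σ) (neg_nonneg.2 hdd)]
    linarith [nonneg_of_mul_nonneg_right this hlam]
  have hK : IsCompact (v ⁻¹' {v c}) :=
    isCompact_Icc.of_isClosed_subset (isClosed_singleton.preimage hv)
      fun y (hy : v y = v c) => Set.Ioo_subset_Icc_self (hmem (hy ▸ hcpos))
  rcases lt_or_gt_of_ne hz0 with h | h
  · obtain ⟨p, hp, hpmax⟩ := hK.exists_isGreatest ⟨c, rfl⟩
    linarith [hpmax (hshift p hp)]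
  · obtain ⟨p, hp, hpmin⟩ := hK.exists_isLeast ⟨c, rfl⟩
    linarith [hpmin (hshift p hp)]

/-- If `v ∈ C²([a,b])` with `v(a) = v(b) = 0`, extended by zero to `ℝ`, satisfies
`𝓛v(x) − 𝓘v(x) = 0` for all `x ∈ (a,b)`, where `𝓛v = −(σ²/2)v'' + μxv'`,
then `v` is identically zero. -/
theorem stmt7 (a b σ μ lam : ℝ) (hab : a < b) (hσ : 0 < σ) (hμ : 0 < μ) (hlam : 0 < lam)
    (φ : ℝ → ℝ) (hφc : Continuous φ) (hφ0 : ∀ y, 0 ≤ φ y) (hφ1 : (∫ y, φ y) = 1)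
    (v : ℝ → ℝ) (hv0 : ∀ x, x ∉ Set.Ioo a b → v x = 0)
    (hvC2 : ContDiffOn ℝ 2 v (Set.Icc a b))
    (heq : ∀ x ∈ Set.Ioo a b,
      -(σ ^ 2 / 2) * deriv (deriv v) x + μ * x * deriv v x - Iop a b lam φ v x = 0) :
    ∀ x, v x = 0 := by
  have hv := ContinuousOn.continuous_of_eq_zero_off_Ioo hab.le hv0 hvC2.continuousOn
  intro x
  refine le_antisymm
    (nonpos_of_integroDifferential_eq_zero hab hlam hφc hφ0 hφ1 hv0 hv heq x) ?_
  have hneg := nonpos_of_integroDifferential_eq_zero (v := -v) (σ := σ) (μ := μ) hab hlam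
    hφc hφ0 hφ1 (fun y hy => by simp [hv0 y hy]) hv.neg (fun y hy => ?_) x
  · simpa using hneg
  · have h := heq y hy
    simp only [Iop, deriv.neg', deriv.fun_neg', Pi.neg_apply, mul_neg, intervalIntegral.integral_neg] at h ⊢
    linarith
end

section
/- Let f ∈ C([a,b]) and let v be a classical solution of the boundary value problem with data f. Then for every γ > 0 satisfying (σ²/2)γ² − μbγ − λ ≥ 1 one has sup_{x ∈ [a,b]} |v(x)| ≤ e^{γ(b−a)} sup_{x ∈ [a,b]} |f(x)|. -/
open MeasureTheory

/-- `v` is a classical solution of the boundary value problem `𝓛v − 𝓘v = f` on `(a,b)`,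
`v = 0` outside `(a,b)`, where `𝓛v = −(σ²/2)v'' + μxv'`. -/
def IsClassicalSolution (a b σ μ lam : ℝ) (φ f v : ℝ → ℝ) : Prop :=
  (∀ x, x ∉ Set.Ioo a b → v x = 0) ∧
  ContDiffOn ℝ 2 v (Set.Icc a b) ∧
  ∀ x ∈ Set.Ioo a b,
    -(σ ^ 2 / 2) * deriv (deriv v) x + μ * x * deriv v x - Iop a b lam φ v x = f x

/-- At a local minimum the second derivative is nonnegative. -/
lemma IsLocalMin.deriv_deriv_nonneg {u : ℝ → ℝ} {x : ℝ} (hmin : IsLocalMin u x)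
    (hu : ContinuousAt u x) : 0 ≤ deriv (deriv u) x := by
  by_contra! hneg
  have hmax : IsLocalMax u x := isLocalMax_of_deriv_deriv_neg hneg hmin.deriv_eq_zero hu
  have hconst : u =ᶠ[nhds x] fun _ => u x := by
    filter_upwards [hmin, hmax] with y h₁ h₂ using le_antisymm h₂ h₁
  have h := hconst.deriv.deriv_eq
  simp at h
  linarith

/-- A probability density has mass at most one on a reflected and translated interval. -/
lemma intervalIntegral_comp_sub_le_one {φ : ℝ → ℝ} (hφ0 : ∀ y, 0 ≤ φ y)
    (hφ1 : (∫ y, φ y) = 1) {a b : ℝ} (hab : a ≤ b) (x : ℝ) :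
    (∫ y in a..b, φ (x - y)) ≤ 1 := by
  have hint : Integrable φ := by
    by_contra h
    rw [integral_undef h] at hφ1
    exact zero_ne_one hφ1
  rw [intervalIntegral.integral_comp_sub_left, intervalIntegral.integral_of_le (by linarith),
    ← hφ1]
  exact setIntegral_le_integral hint (Filter.Eventually.of_forall hφ0)

lemma IsClassicalSolution.neg {a b σ μ lam : ℝ} {φ f v : ℝ → ℝ}
    (hv : IsClassicalSolution a b σ μ lam φ f v) :
    IsClassicalSolution a b σ μ lam φ (-f) (-v) := by
  obtain ⟨h0, h2, heq⟩ := hv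
  refine ⟨fun x hx => by simp [h0 x hx], h2.neg, fun x hx => ?_⟩
  have hd : deriv (-v) = -deriv v := by
    funext y
    exact deriv.neg
  have hdd : deriv (-deriv v) x = -deriv (deriv v) x := deriv.neg
  have h := heq x hx
  simp only [Iop, hd, hdd, Pi.neg_apply, mul_neg, intervalIntegral.integral_neg] at h ⊢
  linarith

/-- Comparison with the barrier `K (e^{γ(b-a)} - e^{γ(x-a)})`. -/
lemma IsClassicalSolution.le_barrier {a b σ μ lam : ℝ} (hab : a < b) (hμ : 0 < μ)
    (hlam : 0 < lam) {φ f v : ℝ → ℝ} (hφc : Continuous φ) (hφ0 : ∀ y, 0 ≤ φ y)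
    (hφ1 : (∫ y, φ y) = 1) (hv : IsClassicalSolution a b σ μ lam φ f v)
    {γ : ℝ} (hγ : 0 < γ) (hγ1 : (σ ^ 2 / 2) * γ ^ 2 - μ * b * γ - lam ≥ 1)
    {K : ℝ} (hK : 0 < K) (hfK : ∀ x ∈ Set.Icc a b, f x ≤ K) :
    ∀ x ∈ Set.Icc a b, v x ≤ K * (Real.exp (γ * (b - a)) - Real.exp (γ * (x - a))) := by
  obtain ⟨h0, h2, heq⟩ := hv
  set w : ℝ → ℝ := fun x => K * (Real.exp (γ * (b - a)) - Real.exp (γ * (x - a))) with hw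
  have hwc : Continuous w := by fun_prop
  have hE (x : ℝ) : HasDerivAt (fun x => Real.exp (γ * (x - a)))
      (Real.exp (γ * (x - a)) * γ) x := by
    simpa using (((hasDerivAt_id x).sub_const a).const_mul γ).exp
  have hw1 (x : ℝ) : HasDerivAt w (-(K * γ) * Real.exp (γ * (x - a))) x :=
    (((hE x).const_sub _).const_mul K).congr_deriv (by ring)
  obtain ⟨x, hx, hmin⟩ := isCompact_Icc.exists_isMinOn (Set.nonempty_Icc.2 hab.le)
    (hwc.continuousOn.sub h2.continuousOn)
  have hmin' : ∀ y ∈ Set.Icc a b, w x - v x ≤ w y - v y := fun y hy => hmin hy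
  suffices hm : 0 ≤ w x - v x from fun y hy => by
    have := hmin' y hy
    change v y ≤ w y
    linarith
  by_contra! hneg
  have hwx : 0 ≤ w x := by
    refine mul_nonneg hK.le (sub_nonneg.2 (Real.exp_le_exp.2 ?_))
    have := hx.2
    gcongr
  have hxI : x ∈ Set.Ioo a b := by
    by_contra h
    rw [h0 x h] at hneg
    linarith
  have hnhds : Set.Ioo a b ∈ nhds x := isOpen_Ioo.mem_nhds hxI
  have h2o : ContDiffOn ℝ 2 v (Set.Ioo a b) := h2.mono Set.Ioo_subset_Icc_self
  have hv1 (y : ℝ) (hy : y ∈ Set.Ioo a b) : HasDerivAt v (deriv v y) y :=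
    ((h2o.contDiffAt (isOpen_Ioo.mem_nhds hy)).differentiableAt two_ne_zero).hasDerivAt
  have hv2 : HasDerivAt (deriv v) (deriv (deriv v) x) x :=
    (((h2o.deriv_of_isOpen (m := 1) isOpen_Ioo (by norm_num)).contDiffAt
      hnhds).differentiableAt one_ne_zero).hasDerivAt
  have hlocmin : IsLocalMin (w - v) x := hmin.isLocalMin (Icc_mem_nhds hxI.1 hxI.2)
  have hu1 (y : ℝ) (hy : y ∈ Set.Ioo a b) : deriv (w - v) y =
      -(K * γ) * Real.exp (γ * (y - a)) - deriv v y := ((hw1 y).sub (hv1 y hy)).deriv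
  have hderiv : deriv v x = -(K * γ) * Real.exp (γ * (x - a)) := by
    have := hu1 x hxI
    rw [hlocmin.deriv_eq_zero] at this
    linarith
  have hderiv2 : deriv (deriv v) x ≤ -(K * γ ^ 2) * Real.exp (γ * (x - a)) := by
    have h := hlocmin.deriv_deriv_nonneg ((hw1 x).sub (hv1 x hxI)).continuousAt
    have hev : deriv (w - v) =ᶠ[nhds x]
        fun y => -(K * γ) * Real.exp (γ * (y - a)) - deriv v y := by
      filter_upwards [hnhds] with y hy using hu1 y hy
    rw [hev.deriv_eq, (((hE x).const_mul (-(K * γ))).fun_sub hv2).deriv] at h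
    linarith
  set e := Real.exp (γ * (x - a)) with he
  have he0 : 0 < e := Real.exp_pos _
  set M := K * (Real.exp (γ * (b - a)) - 1) with hM
  have hwM (y : ℝ) (hy : y ∈ Set.Icc a b) : w y ≤ M := by
    have : 1 ≤ Real.exp (γ * (y - a)) :=
      Real.one_le_exp (mul_nonneg hγ.le (sub_nonneg.2 hy.1))
    simp only [hw, hM]
    gcongr
  have hint : (∫ y in a..b, φ (x - y) * v y) ≤ M - (w x - v x) := by
    calc (∫ y in a..b, φ (x - y) * v y)
        ≤ ∫ y in a..b, φ (x - y) * (M - (w x - v x)) := by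
          refine intervalIntegral.integral_mono_on hab.le
            (ContinuousOn.intervalIntegrable_of_Icc hab.le ?_)
            (Continuous.intervalIntegrable (by fun_prop) _ _) fun y hy => ?_
          · exact ContinuousOn.mul (by fun_prop) h2.continuousOn
          · refine mul_le_mul_of_nonneg_left ?_ (hφ0 _)
            linarith [hwM y hy, hmin' y hy]
      _ = (∫ y in a..b, φ (x - y)) * (M - (w x - v x)) :=
          intervalIntegral.integral_mul_const _ _
      _ ≤ 1 * (M - (w x - v x)) := by
          refine mul_le_mul_of_nonneg_right
            (intervalIntegral_comp_sub_le_one hφ0 hφ1 hab.le x) ?_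
          linarith [hwM x hx]
      _ = M - (w x - v x) := one_mul _
  have hI : Iop a b lam φ v x ≤ lam * (K * (e - 1)) := by
    refine mul_le_mul_of_nonneg_left ?_ hlam.le
    have : w x = K * (Real.exp (γ * (b - a)) - e) := rfl
    linarith
  have hdiff : σ ^ 2 / 2 * (K * γ ^ 2 * e) ≤ -(σ ^ 2 / 2) * deriv (deriv v) x := by
    have := mul_le_mul_of_nonneg_left hderiv2 (by positivity : 0 ≤ σ ^ 2 / 2)
    linarith
  have hdrift : μ * x * (K * γ * e) ≤ μ * b * (K * γ * e) := by
    have := hx.2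
    gcongr
  have hcoef : K * e * 1 ≤ K * e * (σ ^ 2 / 2 * γ ^ 2 - μ * b * γ - lam) :=
    mul_le_mul_of_nonneg_left hγ1 (by positivity)
  have he1 : K * 1 ≤ K * e :=
    mul_le_mul_of_nonneg_left
      (Real.one_le_exp (mul_nonneg hγ.le (sub_nonneg.2 hx.1))) hK.le
  have hf := heq x hxI
  rw [hderiv] at hf
  nlinarith [hfK x hx, mul_pos hlam hK]

/-- Maximum norm bound: if `v` is a classical solution with continuous data `f` and
`γ > 0` satisfies `(σ²/2)γ² − μbγ − λ ≥ 1`, then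
`sup_{[a,b]} |v| ≤ e^{γ(b−a)} sup_{[a,b]} |f|`. -/
theorem stmt9 (a b σ μ lam : ℝ) (hab : a < b) (hσ : 0 < σ) (hμ : 0 < μ) (hlam : 0 < lam)
    (φ : ℝ → ℝ) (hφc : Continuous φ) (hφ0 : ∀ y, 0 ≤ φ y) (hφ1 : (∫ y, φ y) = 1)
    (f : ℝ → ℝ) (hf : ContinuousOn f (Set.Icc a b))
    (v : ℝ → ℝ) (hv : IsClassicalSolution a b σ μ lam φ f v)
    (γ : ℝ) (hγ : 0 < γ) (hγ1 : (σ ^ 2 / 2) * γ ^ 2 - μ * b * γ - lam ≥ 1) :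
    ∀ x ∈ Set.Icc a b,
      |v x| ≤ Real.exp (γ * (b - a)) * sSup ((fun t => |f t|) '' Set.Icc a b) := by
  have hF (x : ℝ) (hx : x ∈ Set.Icc a b) : |f x| ≤ sSup ((fun t => |f t|) '' Set.Icc a b) :=
    le_csSup (isCompact_Icc.bddAbove_image hf.abs) ⟨x, hx, rfl⟩
  set F := sSup ((fun t => |f t|) '' Set.Icc a b)
  have hF0 : 0 ≤ F := (abs_nonneg _).trans (hF a (Set.left_mem_Icc.2 hab.le))
  intro x hx
  have hE : 0 < Real.exp (γ * (b - a)) := Real.exp_pos _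
  rw [← div_le_iff₀' hE]
  refine le_of_forall_gt_imp_ge_of_dense fun K hFK => ?_
  have hK : 0 < K := hF0.trans_lt hFK
  rw [div_le_iff₀' hE]
  have hupper := hv.le_barrier hab hμ hlam hφc hφ0 hφ1 hγ hγ1 hK
    (fun y hy => ((le_abs_self _).trans (hF y hy)).trans hFK.le) x hx
  have hlower := hv.neg.le_barrier hab hμ hlam hφc hφ0 hφ1 hγ hγ1 hK
    (fun y hy => ((neg_le_abs _).trans (hF y hy)).trans hFK.le) x hx
  rw [Pi.neg_apply] at hlower
  have := mul_pos hK (Real.exp_pos (γ * (x - a)))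
  exact abs_le.2 ⟨by linarith, by linarith⟩
end

section
/- Let f ∈ C([a,b]) and let v be a classical solution of the boundary value problem with data f. Then ‖v''‖ ≤ 4σ⁻²‖f‖ + 4σ⁻²(2λ + μ + σ⁻²μ² max(|a|,|b|)²)‖v‖, where ‖·‖ is the L²(a,b)-norm. -/
open MeasureTheory

/-- The `L²(a,b)` norm of a function. -/
noncomputable def L2norm (a b : ℝ) (v : ℝ → ℝ) : ℝ :=
  Real.sqrt (∫ x in a..b, (v x) ^ 2)

lemma L2norm_nonneg (a b : ℝ) (u : ℝ → ℝ) : 0 ≤ L2norm a b u :=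
  Real.sqrt_nonneg _

lemma sq_L2norm {a b : ℝ} (hab : a ≤ b) (u : ℝ → ℝ) :
    L2norm a b u ^ 2 = ∫ x in a..b, (u x) ^ 2 :=
  Real.sq_sqrt (intervalIntegral.integral_nonneg hab fun x _ => sq_nonneg (u x))

lemma L2norm_congr {a b : ℝ} (hab : a ≤ b) {u w : ℝ → ℝ} (h : Set.EqOn u w (Set.Ioo a b)) :
    L2norm a b u = L2norm a b w := by
  unfold L2norm
  congr 1
  exact intervalIntegral.integral_congr_Ioo_of_le hab fun x hx => by simp only [h hx]

lemma L2norm_const_mul (a b c : ℝ) (u : ℝ → ℝ) :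
    L2norm a b (fun x => c * u x) = |c| * L2norm a b u := by
  simp only [L2norm, mul_pow, intervalIntegral.integral_const_mul]
  rw [Real.sqrt_mul (sq_nonneg c), Real.sqrt_sq_eq_abs]

lemma L2norm_mono {a b : ℝ} (hab : a ≤ b) {u w : ℝ → ℝ} (hu : ContinuousOn u (Set.Icc a b))
    (hw : ContinuousOn w (Set.Icc a b)) (h : ∀ x ∈ Set.Icc a b, |u x| ≤ |w x|) :
    L2norm a b u ≤ L2norm a b w :=
  Real.sqrt_le_sqrt <| intervalIntegral.integral_mono_on hab
    ((hu.pow 2).intervalIntegrable_of_Icc hab) ((hw.pow 2).intervalIntegrable_of_Icc hab)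
    fun x hx => sq_le_sq.2 (h x hx)

/-- Cauchy–Schwarz inequality with a nonnegative weight. -/
lemma sq_integral_mul_mul_le {a b : ℝ} (hab : a ≤ b) {p u w : ℝ → ℝ}
    (hp : ContinuousOn p (Set.Icc a b)) (hu : ContinuousOn u (Set.Icc a b))
    (hw : ContinuousOn w (Set.Icc a b)) (hp0 : ∀ x ∈ Set.Icc a b, 0 ≤ p x) :
    (∫ x in a..b, p x * (u x * w x)) ^ 2 ≤
      (∫ x in a..b, p x * (u x) ^ 2) * ∫ x in a..b, p x * (w x) ^ 2 := by
  have key : ∀ t : ℝ, 0 ≤ (∫ x in a..b, p x * (u x) ^ 2) * (t * t) +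
      (2 * ∫ x in a..b, p x * (u x * w x)) * t + ∫ x in a..b, p x * (w x) ^ 2 := by
    intro t
    have h0 : 0 ≤ ∫ x in a..b, p x * (t * u x + w x) ^ 2 :=
      intervalIntegral.integral_nonneg hab fun x hx => mul_nonneg (hp0 x hx) (sq_nonneg _)
    have i1 : IntervalIntegrable (fun x => p x * (u x) ^ 2) volume a b :=
      (hp.mul (hu.pow 2)).intervalIntegrable_of_Icc hab
    have i2 : IntervalIntegrable (fun x => p x * (u x * w x)) volume a b :=
      (hp.mul (hu.mul hw)).intervalIntegrable_of_Icc hab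
    have i3 : IntervalIntegrable (fun x => p x * (w x) ^ 2) volume a b :=
      (hp.mul (hw.pow 2)).intervalIntegrable_of_Icc hab
    have h1 : ∫ x in a..b, p x * (t * u x + w x) ^ 2 =
        ∫ x in a..b, ((t * t) * (p x * (u x) ^ 2) + (2 * t) * (p x * (u x * w x)) +
          p x * (w x) ^ 2) := by
      congr 1; ext x; ring
    rw [h1, intervalIntegral.integral_add ((i1.const_mul _).add (i2.const_mul _)) i3,
      intervalIntegral.integral_add (i1.const_mul _) (i2.const_mul _),
      intervalIntegral.integral_const_mul, intervalIntegral.integral_const_mul] at h0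
    linarith
  have := discrim_le_zero key
  rw [discrim] at this
  linarith

/-- Cauchy–Schwarz inequality in `L²(a,b)`. -/
lemma abs_integral_mul_le {a b : ℝ} (hab : a ≤ b) {u w : ℝ → ℝ}
    (hu : ContinuousOn u (Set.Icc a b)) (hw : ContinuousOn w (Set.Icc a b)) :
    |∫ x in a..b, u x * w x| ≤ L2norm a b u * L2norm a b w := by
  refine abs_le_of_sq_le_sq ?_ (mul_nonneg (L2norm_nonneg ..) (L2norm_nonneg ..))
  rw [mul_pow, sq_L2norm hab, sq_L2norm hab]
  simpa using sq_integral_mul_mul_le hab (p := fun _ => 1) continuousOn_const hu hw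
    fun _ _ => zero_le_one

lemma L2norm_add_le {a b : ℝ} (hab : a ≤ b) {u w : ℝ → ℝ}
    (hu : ContinuousOn u (Set.Icc a b)) (hw : ContinuousOn w (Set.Icc a b)) :
    L2norm a b (fun x => u x + w x) ≤ L2norm a b u + L2norm a b w := by
  refine le_of_sq_le_sq ?_ (add_nonneg (L2norm_nonneg ..) (L2norm_nonneg ..))
  have h1 : ∫ x in a..b, (u x + w x) ^ 2 =
      ∫ x in a..b, ((u x) ^ 2 + 2 * (u x * w x) + (w x) ^ 2) := by
    congr 1; ext x; ring
  have i1 : IntervalIntegrable (fun x => (u x) ^ 2) volume a b :=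
    (hu.pow 2).intervalIntegrable_of_Icc hab
  have i2 : IntervalIntegrable (fun x => u x * w x) volume a b :=
    (hu.mul hw).intervalIntegrable_of_Icc hab
  have i3 : IntervalIntegrable (fun x => (w x) ^ 2) volume a b :=
    (hw.pow 2).intervalIntegrable_of_Icc hab
  rw [sq_L2norm hab, h1, intervalIntegral.integral_add (i1.add (i2.const_mul _)) i3,
    intervalIntegral.integral_add i1 (i2.const_mul _), intervalIntegral.integral_const_mul,
    add_sq, sq_L2norm hab, sq_L2norm hab]
  linarith [(abs_le.1 (abs_integral_mul_le hab hu hw)).2]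

lemma intervalIntegral_swap_of_continuous {a b : ℝ} (hab : a ≤ b) {F : ℝ → ℝ → ℝ}
    (hF : Continuous (Function.uncurry F)) :
    ∫ x in a..b, ∫ y in a..b, F x y = ∫ y in a..b, ∫ x in a..b, F x y := by
  simp only [intervalIntegral.integral_of_le hab]
  refine integral_integral_swap ?_
  rw [Measure.prod_restrict]
  exact (hF.continuousOn.integrableOn_compact (isCompact_Icc.prod isCompact_Icc)).mono_set
    (Set.prod_mono Set.Ioc_subset_Icc_self Set.Ioc_subset_Icc_self)

lemma continuous_convolution_on_interval (a b : ℝ) {φ v : ℝ → ℝ} (hφ : Continuous φ)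
    (hv : Continuous v) : Continuous fun x => ∫ y in a..b, φ (x - y) * v y :=
  intervalIntegral.continuous_parametric_intervalIntegral_of_continuous'
    (f := fun x y => φ (x - y) * v y) (by fun_prop) a b

/-- Young's inequality: convolution with a probability density contracts `L²(a,b)`. -/
lemma L2norm_convolution_le {a b : ℝ} (hab : a ≤ b) {φ v : ℝ → ℝ} (hφ : Continuous φ)
    (hφ0 : ∀ y, 0 ≤ φ y) (hφ1 : ∫ y, φ y = 1) (hv : Continuous v) :
    L2norm a b (fun x => ∫ y in a..b, φ (x - y) * v y) ≤ L2norm a b v := by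
  have hint : Integrable φ := .of_integral_ne_zero (by simp [hφ1])
  have hle : ∀ c d : ℝ, c ≤ d → ∫ y in c..d, φ y ≤ 1 := fun c d hcd => by
    rw [intervalIntegral.integral_of_le hcd, ← hφ1]
    exact setIntegral_le_integral hint (ae_of_all _ hφ0)
  have hc : Continuous fun x => ∫ y in a..b, φ (x - y) * (v y) ^ 2 :=
    continuous_convolution_on_interval a b hφ (hv.pow 2)
  refine Real.sqrt_le_sqrt ?_
  calc ∫ x in a..b, (∫ y in a..b, φ (x - y) * v y) ^ 2
      ≤ ∫ x in a..b, ∫ y in a..b, φ (x - y) * (v y) ^ 2 := by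
        refine intervalIntegral.integral_mono_on hab
          (((continuous_convolution_on_interval a b hφ hv).pow 2).intervalIntegrable _ _)
          (hc.intervalIntegrable _ _) fun x _ => ?_
        have h := sq_integral_mul_mul_le hab (p := fun y => φ (x - y)) (u := fun _ => 1) (w := v)
          (by fun_prop) (by fun_prop) (by fun_prop) fun y _ => hφ0 _
        simp only [one_mul, one_pow, mul_one] at h
        refine h.trans (mul_le_of_le_one_left (intervalIntegral.integral_nonneg hab
          fun y _ => mul_nonneg (hφ0 _) (sq_nonneg _)) ?_)
        rw [intervalIntegral.integral_comp_sub_left]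
        exact hle _ _ (by linarith)
    _ = ∫ y in a..b, ∫ x in a..b, φ (x - y) * (v y) ^ 2 :=
        intervalIntegral_swap_of_continuous hab (by fun_prop)
    _ ≤ ∫ y in a..b, (v y) ^ 2 := by
        refine intervalIntegral.integral_mono_on hab
          (Continuous.intervalIntegrable
            (intervalIntegral.continuous_parametric_intervalIntegral_of_continuous'
              (f := fun y x => φ (x - y) * (v y) ^ 2) (by fun_prop) a b) _ _)
          ((hv.pow 2).intervalIntegrable _ _) fun y _ => ?_
        rw [intervalIntegral.integral_mul_const, intervalIntegral.integral_comp_sub_right]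
        exact mul_le_of_le_one_left (sq_nonneg _) (hle _ _ (by linarith))

lemma continuous_Iop (a b lam : ℝ) {φ v : ℝ → ℝ} (hφ : Continuous φ) (hv : Continuous v) :
    Continuous (Iop a b lam φ v) :=
  continuous_const.mul ((continuous_convolution_on_interval a b hφ hv).sub hv)

lemma L2norm_Iop_le {a b lam : ℝ} (hab : a ≤ b) (hlam : 0 ≤ lam) {φ v : ℝ → ℝ}
    (hφ : Continuous φ) (hφ0 : ∀ y, 0 ≤ φ y) (hφ1 : ∫ y, φ y = 1) (hv : Continuous v) :
    L2norm a b (Iop a b lam φ v) ≤ 2 * lam * L2norm a b v := by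
  have h1 := L2norm_add_le hab (continuous_convolution_on_interval a b hφ hv).continuousOn
    (w := fun x => -1 * v x) (by fun_prop)
  rw [L2norm_const_mul, abs_neg, abs_one, one_mul] at h1
  have h2 := L2norm_convolution_le hab hφ hφ0 hφ1 hv
  have h3 : Iop a b lam φ v =
      fun x => lam * ((∫ y in a..b, φ (x - y) * v y) + -1 * v x) := by
    ext x; simp only [Iop]; ring
  rw [h3, L2norm_const_mul, abs_of_nonneg hlam]
  nlinarith

/-- A function that is continuous on `[a,b]` and vanishes outside `(a,b)` is continuous. -/
lemma continuous_of_continuousOn_Icc_of_eq_zero {a b : ℝ} (hab : a ≤ b) {v : ℝ → ℝ}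
    (hv : ContinuousOn v (Set.Icc a b)) (h0 : ∀ x, x ∉ Set.Ioo a b → v x = 0) :
    Continuous v := by
  have h : v = Set.IccExtend hab (Set.domRestrict (Set.Icc a b) v) := by
    ext x
    rcases le_or_gt x a with hx | hx
    · rw [Set.IccExtend_of_le_left hab _ hx, h0 x fun h => (h.1.trans_le hx).false]
      exact (h0 a (by simp)).symm
    rcases le_or_gt b x with hx' | hx'
    · rw [Set.IccExtend_of_right_le hab _ hx', h0 x fun h => (h.2.trans_le hx').false]
      exact (h0 b (by simp)).symm
    · rw [Set.IccExtend_of_mem hab _ ⟨hx.le, hx'.le⟩]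
      rfl
  rw [h]
  exact hv.domRestrict.Icc_extend'

/-- `‖v'‖² ≤ ‖v‖‖v''‖` for functions vanishing at both endpoints. -/
lemma sq_L2norm_deriv_le {a b : ℝ} (hab : a ≤ b) {v v' v'' : ℝ → ℝ}
    (hv : ContinuousOn v (Set.Icc a b)) (hv' : ContinuousOn v' (Set.Icc a b))
    (hv'' : ContinuousOn v'' (Set.Icc a b)) (hd : ∀ x ∈ Set.Ioo a b, HasDerivAt v (v' x) x)
    (hd' : ∀ x ∈ Set.Ioo a b, HasDerivAt v' (v'' x) x) (ha : v a = 0) (hb : v b = 0) :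
    L2norm a b v' ^ 2 ≤ L2norm a b v * L2norm a b v'' := by
  have h := intervalIntegral.integral_mul_deriv_eq_deriv_mul_of_hasDerivAt
    (a := a) (b := b) (u := v) (v := v') (u' := v') (v' := v'')
    (by rwa [Set.uIcc_of_le hab]) (by rwa [Set.uIcc_of_le hab])
    (by rwa [min_eq_left hab, max_eq_right hab]) (by rwa [min_eq_left hab, max_eq_right hab])
    (hv'.intervalIntegrable_of_Icc hab) (hv''.intervalIntegrable_of_Icc hab)
  have h2 := (abs_le.1 (abs_integral_mul_le hab hv hv'')).1
  rw [sq_L2norm hab]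
  simp only [ha, hb, zero_mul, sub_zero, zero_sub, ← sq] at h
  linarith

/-- For `v` a classical solution with continuous data `f`:
`‖v''‖ ≤ 4σ⁻²‖f‖ + 4σ⁻²(2λ + μ + σ⁻²μ² max(|a|,|b|)²)‖v‖`. -/
theorem stmt10 (a b σ μ lam : ℝ) (hab : a < b) (hσ : 0 < σ) (hμ : 0 < μ) (hlam : 0 < lam)
    (φ : ℝ → ℝ) (hφc : Continuous φ) (hφ0 : ∀ y, 0 ≤ φ y) (hφ1 : (∫ y, φ y) = 1)
    (f : ℝ → ℝ) (hf : ContinuousOn f (Set.Icc a b))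
    (v : ℝ → ℝ) (hv : IsClassicalSolution a b σ μ lam φ f v) :
    L2norm a b (deriv (deriv v)) ≤
      4 / σ ^ 2 * L2norm a b f +
        4 / σ ^ 2 * (2 * lam + μ + μ ^ 2 * (max |a| |b|) ^ 2 / σ ^ 2) * L2norm a b v := by
  obtain ⟨hv0, hC2, heq⟩ := hv
  have hle := hab.le
  have hvc : Continuous v := continuous_of_continuousOn_Icc_of_eq_zero hle hC2.continuousOn hv0
  have hU := uniqueDiffOn_Icc hab
  set v' := derivWithin v (Set.Icc a b)
  set v'' := derivWithin v' (Set.Icc a b)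
  have hC1 : ContDiffOn ℝ 1 v' (Set.Icc a b) := hC2.derivWithin hU (by norm_num)
  have hv'c : ContinuousOn v' (Set.Icc a b) := hC1.continuousOn
  have hv''c : ContinuousOn v'' (Set.Icc a b) := hC1.continuousOn_derivWithin hU le_rfl
  have hd : ∀ x ∈ Set.Ioo a b, HasDerivAt v (v' x) x := fun x hx =>
    ((hC2.differentiableOn (by norm_num) x
      (Set.Ioo_subset_Icc_self hx)).hasDerivWithinAt).hasDerivAt (Icc_mem_nhds hx.1 hx.2)
  have hd' : ∀ x ∈ Set.Ioo a b, HasDerivAt v' (v'' x) x := fun x hx =>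
    ((hC1.differentiableOn (by norm_num) x
      (Set.Ioo_subset_Icc_self hx)).hasDerivWithinAt).hasDerivAt (Icc_mem_nhds hx.1 hx.2)
  have hderiv2 : Set.EqOn (deriv (deriv v)) v'' (Set.Ioo a b) := fun x hx => by
    have : deriv v =ᶠ[nhds x] v' := by
      filter_upwards [isOpen_Ioo.mem_nhds hx] with y hy using (hd y hy).deriv
    rw [this.deriv_eq, (hd' x hx).deriv]
  rw [L2norm_congr hle hderiv2]
  have hinterp := sq_L2norm_deriv_le hle hvc.continuousOn hv'c hv''c hd hd'
    (hv0 a (by simp)) (hv0 b (by simp))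
  set M := max |a| |b|
  have hM0 : 0 ≤ M := (abs_nonneg a).trans (le_max_left _ _)
  have hdrift : L2norm a b (fun x => μ * (x * v' x)) ≤ μ * M * L2norm a b v' := by
    rw [L2norm_const_mul, abs_of_pos hμ, mul_assoc]
    refine mul_le_mul_of_nonneg_left ?_ hμ.le
    rw [← abs_of_nonneg hM0, ← L2norm_const_mul]
    refine L2norm_mono hle (by fun_prop) (by fun_prop) fun x hx => ?_
    rw [abs_mul, abs_mul, abs_of_nonneg hM0]
    exact mul_le_mul_of_nonneg_right (abs_le_max_abs_abs hx.1 hx.2) (abs_nonneg _)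
  have hI := L2norm_Iop_le hle hlam.le hφc hφ0 hφ1 hvc
  have hIc := (continuous_Iop a b lam hφc hvc).continuousOn (s := Set.Icc a b)
  have hmain : σ ^ 2 / 2 * L2norm a b v'' ≤
      μ * M * L2norm a b v' + 2 * lam * L2norm a b v + L2norm a b f := by
    have h1 : σ ^ 2 / 2 * L2norm a b v'' =
        L2norm a b (fun x => μ * (x * v' x) + -1 * (Iop a b lam φ v x + f x)) := by
      rw [← abs_of_pos (show 0 < σ ^ 2 / 2 by positivity), ← L2norm_const_mul]
      refine L2norm_congr hle fun x hx => ?_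
      have := heq x hx
      rw [hderiv2 hx, (hd x hx).deriv] at this
      linarith
    have h2 := L2norm_add_le hle (u := fun x => μ * (x * v' x))
      (w := fun x => -1 * (Iop a b lam φ v x + f x)) (by fun_prop) (by fun_prop)
    have h3 := L2norm_add_le hle hIc hf
    rw [L2norm_const_mul a b (-1), abs_neg, abs_one, one_mul] at h2
    linarith
  have hV := L2norm_nonneg a b v
  have hσ2 : 0 < σ ^ 2 := by positivity
  have hyoung : μ * M * L2norm a b v' ≤
      σ ^ 2 / 4 * L2norm a b v'' + μ ^ 2 * M ^ 2 / σ ^ 2 * L2norm a b v := by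
    have hV'' := L2norm_nonneg a b v''
    refine le_of_sq_le_sq ?_ (by positivity)
    calc (μ * M * L2norm a b v') ^ 2 = (μ * M) ^ 2 * L2norm a b v' ^ 2 := by ring
      _ ≤ (μ * M) ^ 2 * (L2norm a b v * L2norm a b v'') := by gcongr
      _ = 4 * (σ ^ 2 / 4 * L2norm a b v'') * (μ ^ 2 * M ^ 2 / σ ^ 2 * L2norm a b v) := by
        field_simp
      _ ≤ _ := four_mul_le_sq_add _ _
  have hfin : σ ^ 2 / 4 * L2norm a b v'' ≤
      L2norm a b f + (2 * lam + μ + μ ^ 2 * M ^ 2 / σ ^ 2) * L2norm a b v := by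
    nlinarith [mul_nonneg hμ.le hV]
  calc L2norm a b v'' = 4 / σ ^ 2 * (σ ^ 2 / 4 * L2norm a b v'') := by field_simp
    _ ≤ 4 / σ ^ 2 * (L2norm a b f + (2 * lam + μ + μ ^ 2 * M ^ 2 / σ ^ 2) * L2norm a b v) := by
      gcongr
    _ = _ := by ring
end
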